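/- Let a ≥ b ≥ 0 be integers with a + b even, and let X be a real number with X ≠ p. Then F_p(a+2,b;X) − F_p(a,b;X) = (X^{a+1}·(X+p)·(X−1)/(X−p)) · (−p^{b+1}(X−1) + p·X^{b+1} − p^{−1}·X^{b+2}). -/

import Mathlib

/-- The symbol `[u,v]` of Hironaka, for integers `u ≥ v ≥ 0`. -/
noncomputable def bsym (p u v : ℕ) : ℚ :=
  (∏ i ∈ Finset.Icc 1 u, (1 - (-(p : ℚ))⁻¹ ^ i)) /
    ((∏ i ∈ Finset.Icc 1 v, (1 - (-(p : ℚ))⁻¹ ^ i)) *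
      (∏ i ∈ Finset.Icc 1 (u - v), (1 - (-(p : ℚ))⁻¹ ^ i)))

/-- For a pair `a = (a₁, a₂)`, the quantity `a'_i = #{j ∈ {1,2} : a_j ≥ i}`. -/
def dualCt (a : ℕ × ℕ) (i : ℕ) : ℕ :=
  (if i ≤ a.1 then 1 else 0) + (if i ≤ a.2 then 1 else 0)

/-- Hironaka's local factor `I_j(μ, λ)`, for pairs `μ = (c,d)`, `λ = (λ₁,λ₂)`. -/
noncomputable def hirI (p : ℕ) (μ lam : ℕ × ℕ) (j : ℕ) : ℚ :=
  ∑ i ∈ Finset.Icc (dualCt μ (j + 1))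
      (min (dualCt (lam.1 + 1, lam.2 + 1) (j + 1)) (dualCt μ j)),
    (-(p : ℚ)) ^ (i * (2 * dualCt (lam.1 + 1, lam.2 + 1) (j + 1) + 1 - i) / 2) *
      bsym p (dualCt (lam.1 + 1, lam.2 + 1) (j + 1) - dualCt μ (j + 1))
        (dualCt (lam.1 + 1, lam.2 + 1) (j + 1) - i) *
      bsym p (dualCt (lam.1 + 1, lam.2 + 1) j - i)
        (dualCt (lam.1 + 1, lam.2 + 1) j - dualCt μ j)

/-- `ε_n = 0` if `n = 0` and `1` otherwise. -/
def epsn (n : ℕ) : ℕ := if n = 0 then 0 else 1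

/-- The specialization `F_p(a,b;X)` of Hironaka's formula for Hermitian representation
densities: `α(diag(p,1) ⊕ 1_r, diag(p^a, p^b)) = F_p(a,b;(-p)^{-r})`. -/
noncomputable def Fp (p a b : ℕ) (X : ℝ) : ℝ :=
  ∑ c ∈ Finset.range (a + 2), ∑ d ∈ Finset.range (min c (b + 1) + 1),
    (-1 : ℝ) ^ d * ((p : ℝ) ^ (2 * d + c))⁻¹ * X ^ (c + d) *
      (-(p : ℝ)) ^ (epsn c + epsn d) *
      ∏ j ∈ Finset.Icc 1 (a + 1), ((hirI p (c, d) (a, b) j : ℚ) : ℝ)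

/-- Hironaka's local factor in terms of the column lengths `A₀ = λ̃'_j`, `A₁ = λ̃'_{j+1}`,
`m₀ = μ'_j`, `m₁ = μ'_{j+1}`. -/
noncomputable def localFactor (p A₀ A₁ m₀ m₁ : ℕ) : ℚ :=
  ∑ i ∈ Finset.Icc m₁ (min A₁ m₀),
    (-(p : ℚ)) ^ (i * (2 * A₁ + 1 - i) / 2) *
      bsym p (A₁ - m₁) (A₁ - i) * bsym p (A₀ - i) (A₀ - m₀)

theorem hirI_eq_localFactor (p : ℕ) (μ lam : ℕ × ℕ) (j : ℕ) :
    hirI p μ lam j =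
      localFactor p (dualCt (lam.1 + 1, lam.2 + 1) j) (dualCt (lam.1 + 1, lam.2 + 1) (j + 1))
        (dualCt μ j) (dualCt μ (j + 1)) := rfl

theorem dualCt_eq_two {x y i : ℕ} (hx : i ≤ x) (hy : i ≤ y) : dualCt (x, y) i = 2 := by
  simp [dualCt, hx, hy]

theorem dualCt_eq_one {x y i : ℕ} (hx : i ≤ x) (hy : y < i) : dualCt (x, y) i = 1 := by
  simp [dualCt, hx, hy]

theorem dualCt_eq_zero {x y i : ℕ} (hx : x < i) (hy : y < i) : dualCt (x, y) i = 0 := by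
  simp [dualCt, hx, hy]

theorem prod_one_sub_inv_neg_pow_ne_zero {p : ℕ} (hp : 2 ≤ p) (n : ℕ) :
    ∏ i ∈ Finset.Icc 1 n, (1 - (-(p : ℚ))⁻¹ ^ i) ≠ 0 := by
  refine Finset.prod_ne_zero_iff.2 fun i hi h => ?_
  have hi' : i ≠ 0 := by have := (Finset.mem_Icc.1 hi).1; omega
  have h2 : (1 : ℚ) < p := by exact_mod_cast hp
  have habs : |(-(p : ℚ))⁻¹| < 1 := by
    rw [abs_inv, abs_neg, Nat.abs_cast]
    exact inv_lt_one_of_one_lt₀ h2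
  have hlt := pow_lt_one₀ (abs_nonneg _) habs hi'
  rw [← abs_pow, ← sub_eq_zero.1 h, abs_one] at hlt
  exact lt_irrefl _ hlt

theorem bsym_zero_right {p : ℕ} (hp : 2 ≤ p) (u : ℕ) : bsym p u 0 = 1 := by
  simpa [bsym] using div_self (prod_one_sub_inv_neg_pow_ne_zero hp u)

theorem bsym_self {p : ℕ} (hp : 2 ≤ p) (u : ℕ) : bsym p u u = 1 := by
  simpa [bsym] using div_self (prod_one_sub_inv_neg_pow_ne_zero hp u)

theorem bsym_two_one {p : ℕ} (hp : 2 ≤ p) : bsym p 2 1 = 1 + (-(p : ℚ))⁻¹ := by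
  have h1 : (1 : ℚ) - (-(p : ℚ))⁻¹ ≠ 0 := by
    simpa using prod_one_sub_inv_neg_pow_ne_zero hp 1
  simp only [bsym, Finset.prod_Icc_succ_top, Finset.Icc_self, Finset.prod_singleton,
    Nat.one_le_ofNat, Nat.reduceAdd, Nat.reduceSub, pow_one]
  rw [div_eq_iff (mul_ne_zero h1 h1)]
  ring

theorem localFactor_zero_zero {p : ℕ} (hp : 2 ≤ p) (A₀ A₁ : ℕ) :
    localFactor p A₀ A₁ 0 0 = 1 := by
  simp [localFactor, bsym_self hp]

theorem localFactor_one_zero_one_zero {p : ℕ} (hp : 2 ≤ p) : localFactor p 1 0 1 0 = 1 := by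
  simp [localFactor, bsym_self hp, bsym_zero_right hp]

theorem localFactor_one_one {p : ℕ} (hp : 2 ≤ p) {A₀ m₀ : ℕ} (hA : A₀ ≤ 2) (hm : m₀ ≤ A₀)
    (hm1 : 1 ≤ m₀) : localFactor p A₀ 1 m₀ 1 = -(p : ℚ) := by
  interval_cases A₀ <;> interval_cases m₀ <;>
    simp [localFactor, bsym_self hp, bsym_zero_right hp]

theorem localFactor_one_zero_sub {p : ℕ} (hp : 2 ≤ p) {A₀ m₀ : ℕ} (hA : A₀ ≤ 2) (hm : m₀ ≤ A₀)
    (hm1 : 1 ≤ m₀) : localFactor p A₀ 1 m₀ 0 - localFactor p A₀ 0 m₀ 0 = -(p : ℚ) := by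
  have hI : Finset.Icc 0 1 = {0, 1} := rfl
  interval_cases A₀ <;> interval_cases m₀ <;>
    simp [localFactor, bsym_self hp, bsym_zero_right hp, bsym_two_one hp, hI]

theorem localFactor_two_two_two_two {p : ℕ} (hp : 2 ≤ p) :
    localFactor p 2 2 2 2 = (-(p : ℚ)) ^ 3 := by
  simp [localFactor, bsym_self hp]

theorem localFactor_two_two_two_one {p : ℕ} (hp : 2 ≤ p) :
    localFactor p 2 2 2 1 = (-(p : ℚ)) ^ 2 * (1 + -(p : ℚ)) := by
  have hI : Finset.Icc 1 2 = {1, 2} := rfl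
  simp [localFactor, bsym_self hp, bsym_zero_right hp, hI]
  ring

theorem localFactor_two_two_one_one {p : ℕ} (hp : 2 ≤ p) :
    localFactor p 2 2 1 1 = (-(p : ℚ)) ^ 2 := by
  simp [localFactor, bsym_self hp]

/-- The product of the local factors of `μ = (c, d)` over the columns `1, …, n` of `λ̃`, valid as
long as all these columns, and the next one, have length two in `λ̃` and meet the first row
of `μ`. -/
def twoRowProd (p n d : ℕ) : ℚ :=
  if d = 0 then (-(p : ℚ)) ^ (2 * n)
  else if n < d then (-(p : ℚ)) ^ (3 * n)
  else (-(p : ℚ)) ^ (2 * n + d - 1) * (1 + -(p : ℚ))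

theorem prod_hirI_of_le {p a b c d n : ℕ} (hp : 2 ≤ p) (hba : b ≤ a) (hn : n ≤ b) (hc : n < c) :
    ∏ j ∈ Finset.Icc 1 n, hirI p (c, d) (a, b) j = twoRowProd p n d := by
  induction n with
  | zero =>
    rcases Nat.eq_zero_or_pos d with rfl | hd
    · simp [twoRowProd]
    · simp [twoRowProd, hd, hd.ne']
  | succ n ih =>
    rw [Finset.prod_Icc_succ_top (by omega), ih (by omega) (by omega), hirI_eq_localFactor,
      dualCt_eq_two (by simp; omega) (by simp; omega),
      dualCt_eq_two (by simp; omega) (by simp; omega)]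
    rcases lt_trichotomy d (n + 1) with hd | rfl | hd
    · rw [dualCt_eq_one (by omega) (by omega), dualCt_eq_one (by omega) (by omega),
        localFactor_two_two_one_one hp]
      rcases Nat.eq_zero_or_pos d with rfl | hd0
      · simp [twoRowProd]; ring
      · have e : 2 * (n + 1) + d - 1 = (2 * n + d - 1) + 2 := by omega
        simp only [twoRowProd, hd0.ne', if_false, show ¬ n < d by omega,
          show ¬ n + 1 < d by omega, e]
        ring
    · rw [dualCt_eq_two (by omega) (by omega), dualCt_eq_one (by omega) (by omega),
        localFactor_two_two_two_one hp]
      have e : 2 * (n + 1) + (n + 1) - 1 = 3 * n + 2 := by omega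
      simp [twoRowProd, e]; ring
    · rw [dualCt_eq_two (by omega) (by omega), dualCt_eq_two (by omega) (by omega),
        localFactor_two_two_two_two hp]
      simp only [twoRowProd, show d ≠ 0 by omega, if_false, show n < d by omega, if_true,
        show n + 1 < d by omega]
      ring

theorem prod_hirI {p a b c d n : ℕ} (hp : 2 ≤ p) (hd : d ≤ b + 1) (hbn : b ≤ n) (hn : n ≤ a)
    (hc : n < c) :
    ∏ j ∈ Finset.Icc 1 n, hirI p (c, d) (a, b) j
      = twoRowProd p b d * (-(p : ℚ)) ^ (n - b) := by
  induction n, hbn using Nat.le_induction with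
  | base => simp [prod_hirI_of_le hp hn le_rfl hc]
  | succ n hbn ih =>
    rw [Finset.prod_Icc_succ_top (by omega), ih (by omega) (by omega), hirI_eq_localFactor,
      dualCt_eq_one (i := n + 1 + 1) (by simp; omega) (by simp; omega),
      dualCt_eq_one (i := n + 1 + 1) (by omega) (by omega),
      localFactor_one_one hp, Nat.succ_sub hbn, pow_succ, mul_assoc]
    · unfold dualCt; split_ifs <;> omega
    · unfold dualCt; split_ifs <;> omega
    · unfold dualCt; split_ifs <;> omega

theorem hirI_succ_left {p a b c d j : ℕ} (hj : j ≤ a) :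
    hirI p (c, d) (a + 1, b) j = hirI p (c, d) (a, b) j := by
  simp [hirI_eq_localFactor, dualCt, hj, show j ≤ a + 1 by omega, show j ≤ a + 1 + 1 by omega]

theorem dualCt_le_two (x : ℕ × ℕ) (i : ℕ) : dualCt x i ≤ 2 := by
  unfold dualCt; split_ifs <;> omega

theorem hirI_eq_one {p a b c d j : ℕ} (hp : 2 ≤ p) (hc : c < j) (hd : d < j) :
    hirI p (c, d) (a, b) j = 1 := by
  rw [hirI_eq_localFactor, dualCt_eq_zero (x := c) hc hd,
    dualCt_eq_zero (x := c) (by omega) (by omega),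
    localFactor_zero_zero hp]

theorem prod_hirI_succ_left {p a b c d : ℕ} (hp : 2 ≤ p) (hc : c ≤ a) (hd : d ≤ c) :
    ∏ j ∈ Finset.Icc 1 (a + 1 + 1), hirI p (c, d) (a + 1, b) j
      = ∏ j ∈ Finset.Icc 1 (a + 1), hirI p (c, d) (a, b) j := by
  rw [Finset.prod_Icc_succ_top (by omega), Finset.prod_Icc_succ_top (by omega),
    Finset.prod_Icc_succ_top (by omega), hirI_eq_one hp (by omega) (by omega),
    hirI_eq_one hp (by omega) (by omega), hirI_eq_one hp (by omega) (by omega),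
    mul_one, mul_one, mul_one]
  exact Finset.prod_congr rfl fun j hj => hirI_succ_left (Finset.mem_Icc.1 hj).2

theorem prod_hirI_succ_left_sub {p a b d : ℕ} (hp : 2 ≤ p) (hba : b ≤ a) (hd : d ≤ b + 1) :
    ∏ j ∈ Finset.Icc 1 (a + 1 + 1), hirI p (a + 1, d) (a + 1, b) j
        - ∏ j ∈ Finset.Icc 1 (a + 1), hirI p (a + 1, d) (a, b) j
      = twoRowProd p b d * (-(p : ℚ)) ^ (a + 1 - b) := by
  rw [Finset.prod_Icc_succ_top (by omega), Finset.prod_Icc_succ_top (by omega),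
    Finset.prod_Icc_succ_top (by omega), hirI_eq_one (j := a + 1 + 1) hp (by omega) (by omega),
    mul_one, prod_hirI hp hd hba (by omega) (by omega), prod_hirI hp hd hba le_rfl (by omega),
    ← mul_sub,
    hirI_eq_localFactor, hirI_eq_localFactor,
    dualCt_eq_zero (x := a + 1) (i := a + 1 + 1) (by omega) (by omega),
    dualCt_eq_one (x := a + 1 + 1) (i := a + 1 + 1) (by simp) (by simp; omega),
    dualCt_eq_zero (x := a + 1) (i := a + 1 + 1) (by simp) (by simp; omega),
    show dualCt (a + 1 + 1, b + 1) (a + 1) = dualCt (a + 1, b + 1) (a + 1) by simp [dualCt],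
    localFactor_one_zero_sub hp (dualCt_le_two _ _), Nat.succ_sub hba, pow_succ, mul_assoc]
  · unfold dualCt; split_ifs <;> omega
  · simp [dualCt]

theorem prod_hirI_top {p a b d : ℕ} (hp : 2 ≤ p) (hba : b ≤ a) (hd : d ≤ b + 1) :
    ∏ j ∈ Finset.Icc 1 (a + 1 + 1), hirI p (a + 1 + 1, d) (a + 1, b) j
      = twoRowProd p b d * (-(p : ℚ)) ^ (a + 1 - b) := by
  rw [Finset.prod_Icc_succ_top (by omega), prod_hirI hp hd (by omega) le_rfl (by omega),
    hirI_eq_localFactor, dualCt_eq_one (by simp) (by simp; omega),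
    dualCt_eq_zero (by simp) (by simp; omega), dualCt_eq_one (by simp) (by omega),
    dualCt_eq_zero (by simp) (by omega), localFactor_one_zero_one_zero hp, mul_one]

/-- The sum over `d` that occurs as a factor of `Fp p (a + 1) b X - Fp p a b X` for all
`a ≥ b`. -/
noncomputable def rowSum (p b : ℕ) (X : ℝ) : ℝ :=
  ∑ d ∈ Finset.range (b + 2),
    (-1 : ℝ) ^ d * ((p : ℝ) ^ (2 * d))⁻¹ * X ^ d * (-(p : ℝ)) ^ epsn d * (twoRowProd p b d : ℝ)

theorem Fp_succ_sub {p a b : ℕ} (hp : 2 ≤ p) (hba : b ≤ a) (X : ℝ) :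
    Fp p (a + 1) b X - Fp p a b X
      = rowSum p b X * ((-(p : ℝ)) ^ (a + 2 - b) *
          (((p : ℝ) ^ (a + 2))⁻¹ * X ^ (a + 2) + ((p : ℝ) ^ (a + 1))⁻¹ * X ^ (a + 1))) := by
  have hp0 : (p : ℝ) ≠ 0 := by positivity
  have hsub : a + 2 - b = a + 1 - b + 1 := by omega
  have hmin1 : min (a + 1) (b + 1) = b + 1 := by omega
  have hmin2 : min (a + 1 + 1) (b + 1) = b + 1 := by omega
  have he1 : epsn (a + 1) = 1 := rfl
  have he2 : epsn (a + 1 + 1) = 1 := rfl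
  have hsum : ∀ A B C D : ℝ, A + B + C - (A + D) = C + (B - D) := fun A B C D => by ring
  unfold Fp
  rw [Finset.sum_range_succ, Finset.sum_range_succ, Finset.sum_range_succ _ (a + 1)]
  rw [Finset.sum_congr rfl (g := fun c => ∑ d ∈ Finset.range (min c (b + 1) + 1),
    (-1 : ℝ) ^ d * ((p : ℝ) ^ (2 * d + c))⁻¹ * X ^ (c + d) *
      (-(p : ℝ)) ^ (epsn c + epsn d) *
      ∏ j ∈ Finset.Icc 1 (a + 1), ((hirI p (c, d) (a, b) j : ℚ) : ℝ)), hsum,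
    hmin1, hmin2, ← Finset.sum_sub_distrib, ← Finset.sum_add_distrib, rowSum, Finset.sum_mul]
  · refine Finset.sum_congr rfl fun d hd => ?_
    have hd' : d ≤ b + 1 := by have := Finset.mem_range.1 hd; omega
    have htop := congrArg (Rat.cast (K := ℝ)) (prod_hirI_top (a := a) hp hba hd')
    have hdiff := congrArg (Rat.cast (K := ℝ)) (prod_hirI_succ_left_sub (a := a) hp hba hd')
    push_cast at htop hdiff
    rw [htop, ← mul_sub, hdiff, he1, he2, hsub]
    field_simp
    ring
  · intro c hc
    have hc' : c ≤ a := by have := Finset.mem_range.1 hc; omega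
    refine Finset.sum_congr rfl fun d hd => ?_
    have hd' : d ≤ c := by have := Finset.mem_range.1 hd; omega
    have h := congrArg (Rat.cast (K := ℝ)) (prod_hirI_succ_left (b := b) hp hc' hd')
    push_cast at h
    rw [h]

theorem rowSum_eq {p : ℕ} (hp : p ≠ 0) (b : ℕ) (X : ℝ) :
    rowSum p b X = (p : ℝ) ^ (2 * b) * (1 + (1 - p) * ∑ d ∈ Finset.range b, (X / p) ^ (d + 1))
      + (p : ℝ) ^ b * (p : ℝ)⁻¹ * X ^ (b + 1) := by
  have hp0 : (p : ℝ) ≠ 0 := by exact_mod_cast hp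
  rw [rowSum, Finset.sum_range_succ, Finset.sum_range_succ', add_comm (Finset.sum _ _)]
  congr 1
  · rw [mul_add, Finset.mul_sum, Finset.mul_sum]
    congr 1
    · simp [twoRowProd, epsn]
    · refine Finset.sum_congr rfl fun d hd => ?_
      have hd' : ¬ b < d + 1 := by have := Finset.mem_range.1 hd; omega
      have e : 2 * b + (d + 1) - 1 = 2 * b + d := by omega
      have hs : (-1 : ℝ) ^ d * (-1) ^ d = 1 := by rw [← mul_pow]; simp
      simp only [twoRowProd, epsn, Nat.succ_ne_zero, if_false, hd', e]
      push_cast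
      rw [pow_add (-(p : ℝ)), pow_mul (-(p : ℝ)), neg_sq, neg_pow (p : ℝ) d, div_pow]
      field_simp
      linear_combination
        ((1 : ℝ) - p) * X ^ (d + 1) * (p : ℝ) ^ (2 + 2 * d + 2 * b) * hs
  · have hs : (-1 : ℝ) ^ b * (-1) ^ b = 1 := by rw [← mul_pow]; simp
    simp only [twoRowProd, epsn, Nat.succ_ne_zero, if_false, Nat.lt_succ_self, if_true]
    push_cast
    rw [pow_mul (-(p : ℝ)), Odd.neg_pow (n := 3) (by decide), neg_pow ((p : ℝ) ^ 3) b]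
    field_simp
    linear_combination X ^ (b + 1) * (p : ℝ) ^ (2 + 3 * b) * hs

theorem rowSum_mul_sub {p : ℕ} (hp : p ≠ 0) (b : ℕ) (X : ℝ) :
    rowSum p b X * (X - p)
      = -(p : ℝ) ^ b * (-(p : ℝ) ^ (b + 1) * (X - 1) + (p : ℝ) * X ^ (b + 1)
          - (p : ℝ)⁻¹ * X ^ (b + 2)) := by
  have hp0 : (p : ℝ) ≠ 0 := by exact_mod_cast hp
  have hgeom : (p : ℝ) ^ b * (∑ d ∈ Finset.range b, (X / p) ^ (d + 1)) * (X - p)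
      = X * (X ^ b - (p : ℝ) ^ b) := by
    have h := geom_sum_mul (X / p) b
    simp_rw [pow_succ, ← Finset.sum_mul]
    rw [div_pow] at h
    field_simp at h ⊢
    linear_combination X * h
  rw [rowSum_eq hp]
  have hpow : (p : ℝ) ^ (2 * b) = (p : ℝ) ^ b * (p : ℝ) ^ b := by ring
  rw [hpow, add_mul]
  have : (p : ℝ) ^ b * (p : ℝ)⁻¹ * X ^ (b + 1) * (X - p)
      = (p : ℝ) ^ b * (p : ℝ)⁻¹ * X ^ (b + 2) - (p : ℝ) ^ b * X ^ (b + 1) := by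
    field_simp; ring
  rw [this]
  linear_combination (p : ℝ) ^ b * (1 - p) * hgeom

theorem statement12 (p : ℕ) (hp : p.Prime) (hodd : Odd p)
    (a b : ℕ) (hba : b ≤ a) (hev : Even (a + b)) (X : ℝ) (hX : X ≠ (p : ℝ)) :
    Fp p (a + 2) b X - Fp p a b X
      = (X ^ (a + 1) * (X + p) * (X - 1) / (X - p)) *
          (-(p : ℝ) ^ (b + 1) * (X - 1) + (p : ℝ) * X ^ (b + 1)
            - (p : ℝ)⁻¹ * X ^ (b + 2)) := by
  have hp0 : (p : ℝ) ≠ 0 := by exact_mod_cast hp.ne_zero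
  have hX' : X - p ≠ 0 := sub_ne_zero.2 hX
  have h1 := Fp_succ_sub hp.two_le hba X
  have h2 := Fp_succ_sub hp.two_le (show b ≤ a + 1 by omega) X
  have hrow := rowSum_mul_sub hp.ne_zero b X
  obtain ⟨k, rfl⟩ : ∃ k, a = b + 2 * k := by
    obtain ⟨m, hm⟩ := hev
    exact ⟨m - b, by omega⟩
  rw [show b + 2 * k + 2 - b = 2 * (k + 1) by omega, pow_mul (-(p : ℝ)), neg_sq] at h1
  rw [show b + 2 * k + 1 + 2 - b = 2 * (k + 1) + 1 by omega, pow_succ (-(p : ℝ)),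
    pow_mul (-(p : ℝ)), neg_sq] at h2
  have hdiff : Fp p (b + 2 * k + 2) b X - Fp p (b + 2 * k) b X
      = -rowSum p b X * ((p : ℝ) ^ b)⁻¹ * (X ^ (b + 2 * k + 1) * (X + p) * (X - 1)) := by
    rw [← sub_add_sub_cancel _ (Fp p (b + 2 * k + 1) b X), h1, h2]
    field_simp
    ring
  rw [hdiff, div_mul_eq_mul_div, eq_div_iff hX']
  have hb : ((p : ℝ) ^ b)⁻¹ * (p : ℝ) ^ b = 1 := inv_mul_cancel₀ (pow_ne_zero _ hp0)
  linear_combination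
    (-((p : ℝ) ^ b)⁻¹ * (X ^ (b + 2 * k + 1) * (X + p) * (X - 1))) * hrow +
      (X ^ (b + 2 * k + 1) * (X + p) * (X - 1)) * (-(p : ℝ) ^ (b + 1) * (X - 1)
        + (p : ℝ) * X ^ (b + 1) - (p : ℝ)⁻¹ * X ^ (b + 2)) * hb
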